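/- Parabolic Alexandrov–Bakelman–Pucci maximum principle: For every dimension d ≥ 1 there exists a constant C_d > 0, depending only on d, with the following property. Let Ω ⊂ ℝ^d be a nonempty bounded open set, T > 0, and let u be a smooth real-valued function on (closure of Ω) × [0,T]. Let b : Ω × [0,T] → (d×d real symmetric matrices) be measurable with b(x,t) positive semidefinite for all (x,t), and let f : Ω × [0,T] → ℝ satisfy Σ_{i,j} b^{ij}(x,t) ∂_i∂_j u(x,t) − ∂_t u(x,t) ≥ f(x,t) for all (x,t) ∈ Ω × [0,T]. Define D(x,t) := (det b(x,t))^{1/(d+1)}, f⁻ := max(−f,0), the parabolic boundary ∂_P(Ω×[0,T]) := (Ω × {0}) ∪ (∂Ω × [0,T]), and E := { (x,t) ∈ Ω × [0,T] : ∂_t u(x,t) ≥ 0 and the spatial Hessian D²_x u(x,t) is negative semidefinite }. Then sup_{Ω×[0,T]} u ≤ sup_{∂_P(Ω×[0,T])} u + C_d · (diam Ω)^{d/(d+1)} · ( ∫_E (f⁻/D)^{d+1} dx dt )^{1/(d+1)} (with the convention that the right-hand side is +∞ if D vanishes on a subset of E where f⁻ > 0). -/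

import Mathlib

open MeasureTheory

theorem det_prod_shear {E : Type*} [AddCommGroup E] [Module ℝ E] [FiniteDimensional ℝ E]
    (A : E →ₗ[ℝ] E) (w : E) (c : ℝ) (a : E →ₗ[ℝ] ℝ) (J : E × ℝ →ₗ[ℝ] E × ℝ)
    (hJ : ∀ y s, J (y, s) = (A y + s • w, c * s - a (A y + s • w))) :
    LinearMap.det J = LinearMap.det A * c := by
  have h : J = LinearMap.transvection (-(a ∘ₗ LinearMap.fst ℝ E ℝ)) ((0 : E), (1 : ℝ)) ∘ₗ
      (LinearMap.prodMap LinearMap.id (c • LinearMap.id)) ∘ₗ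
      LinearMap.transvection (LinearMap.snd ℝ E ℝ) (w, (0 : ℝ)) ∘ₗ
      LinearMap.prodMap A LinearMap.id := by
    refine LinearMap.ext fun ⟨y, s⟩ => ?_
    rw [hJ]
    simp [LinearMap.transvection.apply, sub_eq_add_neg]
  rw [h, LinearMap.det_comp, LinearMap.det_comp, LinearMap.det_comp, LinearMap.det_prodMap,
    LinearMap.det_prodMap, LinearMap.transvection.det, LinearMap.transvection.det]
  simp [mul_comm]

theorem IsLocalMax.second_deriv_nonpos {g g' : ℝ → ℝ} {a c : ℝ} (h : IsLocalMax g a)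
    (hg : ∀ᶠ r in nhds a, HasDerivAt g (g' r) r) (hg' : HasDerivAt g' c a) : c ≤ 0 := by
  by_contra! hc
  let k : ℝ → ℝ := fun r => g r - c / 4 * (r - a) ^ 2
  have hk : ∀ᶠ r in nhds a, HasDerivAt k (g' r - c / 2 * (r - a)) r := by
    filter_upwards [hg] with r hr
    have := hr.sub ((((hasDerivAt_id r).sub_const a).pow 2).const_mul (c / 4))
    exact this.congr_deriv (by simp; ring)
  have hg0 : g' a = 0 := h.hasDerivAt_eq_zero hg.self_of_nhds
  have hk1 : deriv k =ᶠ[nhds a] fun r => g' r - c / 2 * (r - a) := hk.mono fun r hr => hr.deriv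
  have hk2 : deriv (deriv k) a = c / 2 := by
    rw [hk1.deriv_eq]
    have := hg'.sub (((hasDerivAt_id a).sub_const a).const_mul (c / 2))
    exact (HasDerivAt.deriv this).trans (by ring)
  have hmin : IsLocalMin k a := isLocalMin_of_deriv_deriv_pos (by rw [hk2]; linarith)
    (by rw [hk1.self_of_nhds]; simp [hg0]) hk.self_of_nhds.continuousAt
  have hev : ∀ᶠ r in nhdsWithin a {a}ᶜ, False := by
    filter_upwards [nhdsWithin_le_nhds h, nhdsWithin_le_nhds hmin, self_mem_nhdsWithin]
      with r h1 h2 h3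
    have h4 : 0 < (r - a) ^ 2 := by
      have : r - a ≠ 0 := sub_ne_zero.2 h3
      positivity
    simp only [k, sub_self] at h2
    nlinarith
  exact hev.exists.elim fun _ => id

open scoped MatrixOrder in
theorem Matrix.PosSemidef.succ_mul_det_rpow_le_trace {n : Type*} [Fintype n] [DecidableEq n]
    {B A : Matrix n n ℝ} (hB : B.PosSemidef) (hA : A.PosSemidef) {c : ℝ} (hc : 0 ≤ c) :
    (Fintype.card n + 1) * (B.det * (A.det * c)) ^ ((1 : ℝ) / (Fintype.card n + 1)) ≤
      (B * A).trace + c := by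
  obtain ⟨S, rfl⟩ : ∃ S : Matrix n n ℝ, B = S.conjTranspose * S :=
    CStarAlgebra.nonneg_iff_eq_star_mul_self.mp hB.nonneg
  have hC := hA.mul_mul_conjTranspose_same S
  have h := Real.geom_mean_le_arith_mean (Finset.univ : Finset (Option n)) (fun _ => 1)
    (fun o => o.elim c hC.isHermitian.eigenvalues) (by simp)
    (by simp; positivity) (by rintro (_ | i) -; exacts [hc, hC.eigenvalues_nonneg i])
  have ht := hC.isHermitian.trace_eq_sum_eigenvalues
  have hd := hC.isHermitian.det_eq_prod_eigenvalues
  simp only [Real.rpow_one, Fintype.prod_option, Fintype.sum_option, Option.elim, one_mul,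
    Finset.sum_const, Finset.card_univ, nsmul_eq_mul, mul_one, Fintype.card_option] at h
  have hdet : (S.conjTranspose * S).det * (A.det * c) = c * (S * A * S.conjTranspose).det := by
    simp only [Matrix.det_mul]; ring
  have htr : (S.conjTranspose * S * A).trace = (S * A * S.conjTranspose).trace := by
    rw [Matrix.mul_assoc, Matrix.trace_mul_comm]
  rw [hdet, htr, ht, hd]
  rw [le_div_iff₀ (by positivity)] at h
  push_cast at h
  simp only [RCLike.ofReal_real_eq_id, id, one_div]
  linarith

theorem Matrix.PosSemidef.ofReal_det_mul_le {d : ℕ} {B A : Matrix (Fin d) (Fin d) ℝ}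
    (hB : B.PosSemidef) (hA : A.PosSemidef) {c f : ℝ} (hc : 0 ≤ c)
    (hf : f ≤ -(B * A).trace - c) :
    ENNReal.ofReal (A.det * c) ≤
      (ENNReal.ofReal (max (-f) 0) / ENNReal.ofReal (B.det ^ ((1 : ℝ) / (d + 1)))) ^ (d + 1) := by
  have hdet := mul_nonneg hA.det_nonneg hc
  have hamgm := hB.succ_mul_det_rpow_le_trace hA hc
  have htr := hB.succ_mul_det_rpow_le_trace hA le_rfl
  rw [mul_zero, mul_zero, Real.zero_rpow (by positivity), mul_zero, add_zero] at htr
  rw [Fintype.card_fin, Real.mul_rpow hB.det_nonneg hdet] at hamgm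
  set D := B.det ^ ((1 : ℝ) / (d + 1)) with hD
  set δ := (A.det * c) ^ ((1 : ℝ) / (d + 1)) with hδ
  have hδ0 : 0 ≤ δ := Real.rpow_nonneg hdet _
  have hD0 : 0 ≤ D := Real.rpow_nonneg hB.det_nonneg _
  have hpow : A.det * c = δ ^ (d + 1) := by
    rw [hδ, ← Real.rpow_natCast, ← Real.rpow_mul hdet]
    push_cast
    rw [one_div_mul_cancel (by positivity), Real.rpow_one]
  rw [hpow, ENNReal.ofReal_pow hδ0]
  gcongr
  have hDδ : δ * D ≤ max (-f) 0 := by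
    refine le_max_of_le_left ?_
    have h1 : 0 ≤ (d : ℝ) * (D * δ) := by positivity
    linarith
  by_cases h0 : D = 0 ∧ max (-f) 0 = 0
  · have hc0 : c = 0 := by
      have := (max_eq_right_iff.1 h0.2)
      linarith
    rw [hδ, hc0, mul_zero, Real.zero_rpow (by positivity)]
    simp
  · rw [ENNReal.le_div_iff_mul_le _ (Or.inl ENNReal.ofReal_ne_top), ← ENNReal.ofReal_mul hδ0]
    · exact ENNReal.ofReal_le_ofReal hDδ
    · rw [not_and_or] at h0
      refine h0.imp (fun h => ?_) fun h => ?_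
      · exact (ENNReal.ofReal_pos.2 (hD0.lt_of_ne' h)).ne'
      · exact (ENNReal.ofReal_pos.2 ((le_max_right _ _).lt_of_ne' h)).ne'

section Calculus

variable {E : Type*} [NormedAddCommGroup E] [InnerProductSpace ℝ E]

theorem deriv_slice_eq {u : E × ℝ → ℝ} {p : E × ℝ} (hu : DifferentiableAt ℝ u p) :
    deriv (fun s => u (p.1, s)) p.2 = fderiv ℝ u p (0, 1) :=
  (hu.hasFDerivAt.comp_hasDerivAt p.2
    ((hasDerivAt_const p.2 p.1).prodMk (hasDerivAt_id p.2))).deriv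

theorem fderiv_slice_eq {u : E × ℝ → ℝ} {p : E × ℝ} (hu : DifferentiableAt ℝ u p) :
    fderiv ℝ (fun y => u (y, p.2)) p.1 = (fderiv ℝ u p).comp (.inl ℝ E ℝ) :=
  (hu.hasFDerivAt.comp p.1 (hasFDerivAt_prodMk_left p.1 p.2)).fderiv

theorem ContDiffAt.eventually_differentiableAt {u : E × ℝ → ℝ} {p : E × ℝ}
    (hu : ContDiffAt ℝ 2 u p) : ∀ᶠ q in nhds p, DifferentiableAt ℝ u q :=
  (hu.eventually (by simp)).mono fun _ hq => hq.differentiableAt (by norm_num)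

theorem ContDiffAt.hasFDerivAt_fderiv {u : E × ℝ → ℝ} {p : E × ℝ} (hu : ContDiffAt ℝ 2 u p) :
    HasFDerivAt (fderiv ℝ u) (fderiv ℝ (fderiv ℝ u) p) p :=
  ((hu.fderiv_right (m := 1) (by norm_num)).differentiableAt (by norm_num)).hasFDerivAt

theorem iteratedFDeriv_two_slice_eq {u : E × ℝ → ℝ} {p : E × ℝ} (hu : ContDiffAt ℝ 2 u p)
    (v w : E) : iteratedFDeriv ℝ 2 (fun y => u (y, p.2)) p.1 ![v, w] =
      fderiv ℝ (fderiv ℝ u) p (v, 0) (w, 0) := by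
  have hc : Filter.Tendsto (fun y : E => (y, p.2)) (nhds p.1) (nhds p) := by
    have : Continuous fun y : E => (y, p.2) := by fun_prop
    exact this.tendsto p.1
  have h1 : fderiv ℝ (fun y => u (y, p.2)) =ᶠ[nhds p.1]
      fun y => (fderiv ℝ u (y, p.2)).comp (.inl ℝ E ℝ) :=
    (hc.eventually hu.eventually_differentiableAt).mono fun y hy =>
      fderiv_slice_eq (p := (y, p.2)) hy
  have h2 : HasFDerivAt (fun y => fderiv ℝ u (y, p.2))
      ((fderiv ℝ (fderiv ℝ u) p).comp (.inl ℝ E ℝ)) p.1 := by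
    have h3 : HasFDerivAt (fun y : E => (y, p.2)) (.inl ℝ E ℝ) p.1 :=
      hasFDerivAt_prodMk_left p.1 p.2
    exact HasFDerivAt.comp (g := fderiv ℝ u) p.1 hu.hasFDerivAt_fderiv h3
  rw [iteratedFDeriv_two_apply, h1.fderiv_eq,
    (h2.clm_comp (hasFDerivAt_const (ContinuousLinearMap.inl ℝ E ℝ) p.1)).fderiv]
  simp

variable [CompleteSpace E]

variable (E) in
/-- The inverse of the Riesz isomorphism of a real Hilbert space, as a linear map. -/
noncomputable def rieszSymm : (E →L[ℝ] ℝ) →L[ℝ] E :=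
  LinearMap.mkContinuous
    { toFun := (InnerProductSpace.toDual ℝ E).symm
      map_add' := by simp
      map_smul' := by simp } 1 (by simp)

theorem inner_rieszSymm (φ : E →L[ℝ] ℝ) (v : E) : inner ℝ (rieszSymm E φ) v = φ v := by
  simp [rieszSymm]

/-- The gradient of `u : E × ℝ → ℝ` in the spatial variable. -/
noncomputable def spatialGradient (u : E × ℝ → ℝ) (p : E × ℝ) : E :=
  rieszSymm E ((fderiv ℝ u p).comp (.inl ℝ E ℝ))

theorem inner_spatialGradient (u : E × ℝ → ℝ) (p : E × ℝ) (v : E) :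
    inner ℝ (spatialGradient u p) v = fderiv ℝ u p (v, 0) := by
  simp [spatialGradient, inner_rieszSymm]

/-- The slope, and the value at `x₀`, of the affine function tangent to `u (·, p.2)` at `p.1`. -/
noncomputable def parabolicLegendre (u : E × ℝ → ℝ) (x₀ : E) (p : E × ℝ) : E × ℝ :=
  (spatialGradient u p, u p - inner ℝ (spatialGradient u p) (p.1 - x₀))

/-- The derivative of the spatial gradient. -/
noncomputable def spatialGradientDeriv (u : E × ℝ → ℝ) (p : E × ℝ) : E × ℝ →L[ℝ] E :=
  rieszSymm E ∘L
    ((ContinuousLinearMap.compL ℝ E (E × ℝ) ℝ).flip (.inl ℝ E ℝ)) ∘L fderiv ℝ (fderiv ℝ u) p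

theorem inner_spatialGradientDeriv (u : E × ℝ → ℝ) (p y : E × ℝ) (v : E) :
    inner ℝ (spatialGradientDeriv u p y) v = fderiv ℝ (fderiv ℝ u) p y (v, 0) := by
  simp [spatialGradientDeriv, inner_rieszSymm]

theorem hasFDerivAt_spatialGradient {u : E × ℝ → ℝ} {p : E × ℝ} (hu : ContDiffAt ℝ 2 u p) :
    HasFDerivAt (spatialGradient u) (spatialGradientDeriv u p) p :=
  (ContinuousLinearMap.hasFDerivAt (rieszSymm E ∘L
    ((ContinuousLinearMap.compL ℝ E (E × ℝ) ℝ).flip (.inl ℝ E ℝ)))).comp p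
    hu.hasFDerivAt_fderiv

theorem hasFDerivAt_parabolicLegendre {u : E × ℝ → ℝ} {p : E × ℝ} (hu : ContDiffAt ℝ 2 u p)
    (x₀ : E) : ∃ J : E × ℝ →L[ℝ] E × ℝ, HasFDerivAt (parabolicLegendre u x₀) J p ∧
      ∀ y s, J (y, s) = (spatialGradientDeriv u p (y, s),
        fderiv ℝ u p (0, 1) * s - inner ℝ (p.1 - x₀) (spatialGradientDeriv u p (y, s))) := by
  have hg := hasFDerivAt_spatialGradient hu
  have h1 := (hu.differentiableAt (by norm_num)).hasFDerivAt.sub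
    (hg.inner ℝ ((hasFDerivAt_fst (𝕜 := ℝ) (p := p)).sub_const x₀))
  refine ⟨_, hg.prodMk h1, fun y s => ?_⟩
  have h2 : fderiv ℝ u p (y, s) = fderiv ℝ u p (y, 0) + s * fderiv ℝ u p (0, 1) := by
    rw [← smul_eq_mul, ← map_smul, ← map_add]; simp
  simp [fderivInnerCLM_apply, h2, inner_spatialGradient, real_inner_comm (p.1 - x₀)]
  ring

end Calculus

theorem det_fderiv_parabolicLegendre {d : ℕ} {u : EuclideanSpace ℝ (Fin d) × ℝ → ℝ}
    {p : EuclideanSpace ℝ (Fin d) × ℝ} (hu : ContDiffAt ℝ 2 u p)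
    (x₀ : EuclideanSpace ℝ (Fin d)) :
    (fderiv ℝ (parabolicLegendre u x₀) p).det =
      (Matrix.of fun i j : Fin d => fderiv ℝ (fderiv ℝ u) p
        (EuclideanSpace.single i 1, 0) (EuclideanSpace.single j 1, 0)).det *
      fderiv ℝ u p (0, 1) := by
  obtain ⟨J, hJ, hJ'⟩ := hasFDerivAt_parabolicLegendre hu x₀
  rw [hJ.fderiv, ContinuousLinearMap.det, det_prod_shear
    ((spatialGradientDeriv u p ∘L .inl ℝ _ ℝ : _ →L[ℝ] _) : _ →ₗ[ℝ] _)
    (spatialGradientDeriv u p (0, 1)) (fderiv ℝ u p (0, 1))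
    ((innerSL ℝ (p.1 - x₀) : _ →L[ℝ] ℝ) : _ →ₗ[ℝ] ℝ), ← Matrix.det_transpose,
    ← LinearMap.det_toMatrix (EuclideanSpace.basisFun (Fin d) ℝ).toBasis]
  · congr 2
    ext i j
    rw [LinearMap.toMatrix_apply]
    have := inner_spatialGradientDeriv u p (EuclideanSpace.single j 1, 0) (EuclideanSpace.single i 1)
    rw [Matrix.transpose_apply, Matrix.of_apply, ← this, EuclideanSpace.inner_single_right]
    simp
  · intro y s
    have : spatialGradientDeriv u p (y, s) =
        spatialGradientDeriv u p (y, 0) + s • spatialGradientDeriv u p (0, 1) := by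
      rw [← map_smul, ← map_add]; simp
    simp only [ContinuousLinearMap.coe_coe] at *
    rw [hJ', this]
    simp [-map_sub]

theorem fderiv_fderiv_nonpos_of_isLocalMax {E : Type*} [NormedAddCommGroup E]
    [InnerProductSpace ℝ E] {u : E × ℝ → ℝ} {x x₀ q : E} {t h : ℝ} (hu : ContDiffAt ℝ 2 u (x, t))
    (hmax : IsLocalMax (fun y => u (y, t) - (h + inner ℝ q (y - x₀))) x) (z : E) :
    fderiv ℝ (fderiv ℝ u) (x, t) (z, 0) (z, 0) ≤ 0 := by
  have hlin : ∀ r : ℝ, HasDerivAt (fun r : ℝ => x + r • z) z r := fun r => by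
    simpa using ((hasDerivAt_id r).smul_const z).const_add x
  have hline : ∀ r : ℝ, HasDerivAt (fun r : ℝ => (x + r • z, t)) (z, 0) r := fun r =>
    (hlin r).prodMk (hasDerivAt_const r t)
  have htend : Filter.Tendsto (fun r : ℝ => (x + r • z, t)) (nhds 0) (nhds (x, t)) := by
    simpa using (hline 0).continuousAt.tendsto
  have htend' : Filter.Tendsto (fun r : ℝ => x + r • z) (nhds 0) (nhds x) := by
    simpa using (hlin 0).continuousAt.tendsto
  have hm : IsLocalMax (fun r : ℝ => u (x + r • z, t) - (h + inner ℝ q (x + r • z - x₀))) 0 := by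
    filter_upwards [htend'.eventually hmax] with r hr
    simpa using hr
  refine hm.second_deriv_nonpos
    (g' := fun r => fderiv ℝ u (x + r • z, t) (z, 0) - inner ℝ q z) ?_ ?_
  · filter_upwards [htend.eventually hu.eventually_differentiableAt] with r hr
    have h1 : HasDerivAt (fun r : ℝ => u (x + r • z, t)) (fderiv ℝ u (x + r • z, t) (z, 0)) r :=
      hr.hasFDerivAt.comp_hasDerivAt r (hline r)
    have h2 : HasDerivAt (fun r : ℝ => inner ℝ q (x + r • z - x₀)) (inner ℝ q z) r :=
      (innerSL ℝ q).hasFDerivAt.comp_hasDerivAt r ((hlin r).sub_const x₀)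
    exact h1.sub (h2.const_add h)
  · have h1 : HasFDerivAt (fderiv ℝ u) (fderiv ℝ (fderiv ℝ u) (x, t)) (x + (0 : ℝ) • z, t) := by
      simpa using hu.hasFDerivAt_fderiv
    have h2 : HasDerivAt (fun r : ℝ => fderiv ℝ u (x + r • z, t))
        (fderiv ℝ (fderiv ℝ u) (x, t) (z, 0)) 0 :=
      HasFDerivAt.comp_hasDerivAt (l := fderiv ℝ u) (0 : ℝ) h1 (hline 0)
    have h3 : HasDerivAt (fun r : ℝ => fderiv ℝ u (x + r • z, t) (z, 0))
        (fderiv ℝ (fderiv ℝ u) (x, t) (z, 0) (z, 0)) 0 := by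
      simpa using h2.clm_apply (hasDerivAt_const (0 : ℝ) ((z, 0) : E × ℝ))
    exact h3.sub_const (inner ℝ q z)

theorem exists_parabolicLegendre_eq {E : Type*} [NormedAddCommGroup E] [InnerProductSpace ℝ E]
    [FiniteDimensional ℝ E] {Ω : Set E} {T m t₀ : ℝ} {u : E × ℝ → ℝ} {x₀ : E}
    (hΩ : IsOpen Ω) (hb : Bornology.IsBounded Ω)
    (hc : ContinuousOn u (closure Ω ×ˢ Set.Icc 0 T))
    (hu : ∀ p ∈ Ω ×ˢ Set.Ioo 0 T, ContDiffAt ℝ 2 u p)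
    (hm : ∀ p ∈ (Ω ×ˢ ({0} : Set ℝ)) ∪ (frontier Ω ×ˢ Set.Icc (0 : ℝ) T), u p ≤ m)
    (hx₀ : x₀ ∈ Ω) (ht₀ : t₀ ∈ Set.Ico 0 T) {q : E} {h : ℝ}
    (hq : ‖q‖ * Metric.diam Ω < h - m) (hh : h < u (x₀, t₀)) :
    ∃ p ∈ Ω ×ˢ Set.Ioo 0 T, (0 ≤ fderiv ℝ u p (0, 1) ∧
      ∀ z : E, fderiv ℝ (fderiv ℝ u) p (z, 0) (z, 0) ≤ 0) ∧ parabolicLegendre u x₀ p = (q, h) := by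
  set ℓ : E → ℝ := fun y => h + inner ℝ q (y - x₀) with hℓ
  have hℓc : Continuous ℓ := by fun_prop
  have hℓm : ∀ y ∈ closure Ω, m < ℓ y := by
    intro y hy
    have h1 : ‖y - x₀‖ ≤ Metric.diam Ω := by
      rw [← dist_eq_norm, ← Metric.diam_closure]
      exact Metric.dist_le_diam_of_mem hb.closure hy (subset_closure hx₀)
    have h2 := abs_le.1 (abs_real_inner_le_norm q (y - x₀))
    have h3 := mul_le_mul_of_nonneg_left h1 (norm_nonneg q)
    simp only [hℓ]
    linarith [h2.1]
  have hcpt : IsCompact (closure Ω ×ˢ Set.Icc 0 T) :=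
    (hb.isCompact_closure).prod isCompact_Icc
  have hcd : ContinuousOn (fun p : E × ℝ => u p - ℓ p.1) (closure Ω ×ˢ Set.Icc 0 T) :=
    hc.sub (by fun_prop)
  have hK : IsCompact ((closure Ω ×ˢ Set.Icc 0 T) ∩ (fun p : E × ℝ => u p - ℓ p.1) ⁻¹' Set.Ici 0) :=
    hcpt.of_isClosed_subset (hcd.preimage_isClosed_of_isClosed hcpt.isClosed isClosed_Ici)
      Set.inter_subset_left
  obtain ⟨⟨x, t⟩, ⟨⟨hx, ht⟩, hxt⟩, hmin⟩ := hK.exists_isMinOn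
    ⟨(x₀, t₀), ⟨subset_closure hx₀, ht₀.1, ht₀.2.le⟩, by simp [hℓ]; linarith⟩
    continuous_snd.continuousOn
  simp only [Set.mem_preimage, Set.mem_Ici, sub_nonneg] at hxt hx ht
  have htT : t < T := lt_of_le_of_lt (isMinOn_iff.1 hmin (x₀, t₀)
    ⟨⟨subset_closure hx₀, ht₀.1, ht₀.2.le⟩, by simp [hℓ]; linarith⟩) ht₀.2
  have hxΩ : x ∈ Ω := by
    by_contra hcon
    have := hm (x, t) (Or.inr ⟨by rw [hΩ.frontier_eq]; exact ⟨hx, hcon⟩, ht⟩)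
    linarith [hℓm x hx]
  have ht0 : 0 < t := by
    refine lt_of_le_of_ne ht.1 fun h0 => ?_
    have := hm (x, t) (Or.inl ⟨hxΩ, h0.symm⟩)
    linarith [hℓm x hx]
  have hbefore : ∀ y ∈ closure Ω, ∀ s ∈ Set.Ico 0 t, u (y, s) < ℓ y := by
    intro y hy s hs
    by_contra! hcon
    have : t ≤ s := isMinOn_iff.1 hmin (y, s)
      ⟨⟨hy, hs.1, by linarith [hs.2, ht.2]⟩, by simpa using hcon⟩
    linarith [hs.2]
  have hp : ∀ y ∈ Ω, (y, t) ∈ Ω ×ˢ Set.Ioo 0 T := fun y hy => ⟨hy, ht0, htT⟩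
  have hcs : ∀ y ∈ Ω, ContinuousAt (fun s => u (y, s)) t := fun y hy =>
    (hu _ (hp y hy)).continuousAt.comp (x := t) (f := fun s => (y, s)) (by fun_prop)
  have hat : ∀ y ∈ Ω, u (y, t) ≤ ℓ y := by
    intro y hy
    refine le_of_tendsto ((hcs y hy).tendsto.mono_left (nhdsWithin_le_nhds (s := Set.Iio t))) ?_
    filter_upwards [Ioo_mem_nhdsLT ht0] with s hs
    exact (hbefore y (subset_closure hy) s ⟨hs.1.le, hs.2⟩).le
  have hxt' : u (x, t) = ℓ x := le_antisymm (hat x hxΩ) hxt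
  have hux := hu _ (hp x hxΩ)
  have hdx := hux.differentiableAt (by norm_num)
  have hmax : IsLocalMax (fun y => u (y, t) - ℓ y) x := by
    filter_upwards [hΩ.mem_nhds hxΩ] with y hy
    linarith [hat y hy]
  have hgrad : spatialGradient u (x, t) = q := by
    refine ext_inner_right ℝ fun v => ?_
    rw [inner_spatialGradient]
    have h1 : HasFDerivAt (fun y => u (y, t)) ((fderiv ℝ u (x, t)).comp (.inl ℝ E ℝ)) x :=
      hdx.hasFDerivAt.comp x (hasFDerivAt_prodMk_left x t)
    have h2 : HasFDerivAt ℓ (innerSL ℝ q) x :=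
      ((innerSL ℝ q).hasFDerivAt.comp x ((hasFDerivAt_id x).sub_const x₀)).const_add h
    have h3 := congrArg (fun L => L v) (hmax.hasFDerivAt_eq_zero (h1.sub h2))
    simpa [sub_eq_zero] using h3
  refine ⟨(x, t), hp x hxΩ, ⟨?_, fun z => ?_⟩, ?_⟩
  · rw [← deriv_slice_eq hdx]
    have hds : DifferentiableAt ℝ (fun s => u (x, s)) t :=
      hdx.comp (f := fun s => (x, s)) t (by fun_prop)
    have := hds.hasDerivAt.hasDerivWithinAt (s := Set.Iio t)
    rw [hasDerivWithinAt_iff_tendsto_slope' (by simp)] at this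
    refine ge_of_tendsto this ?_
    filter_upwards [Ioo_mem_nhdsLT ht0] with s hs
    have := hbefore x hx s ⟨hs.1.le, hs.2⟩
    rw [slope_def_field]
    exact div_nonneg_of_nonpos (by linarith) (by linarith [hs.2])
  · exact fderiv_fderiv_nonpos_of_isLocalMax hux hmax z
  · simp only [parabolicLegendre, hgrad, hxt', hℓ]
    simp

/-- The points of `U` where `u` is nondecreasing in time and spatially concave to second order. -/
def parabolicContactSet {E : Type*} [NormedAddCommGroup E] [NormedSpace ℝ E] (u : E × ℝ → ℝ)
    (U : Set (E × ℝ)) : Set (E × ℝ) :=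
  {p ∈ U | 0 ≤ fderiv ℝ u p (0, 1) ∧ ∀ z : E, fderiv ℝ (fderiv ℝ u) p (z, 0) (z, 0) ≤ 0}

theorem measurableSet_parabolicContactSet {E : Type*} [NormedAddCommGroup E] [NormedSpace ℝ E]
    [MeasurableSpace (E × ℝ)] [OpensMeasurableSpace (E × ℝ)] {u : E × ℝ → ℝ}
    {U : Set (E × ℝ)} (hU : IsOpen U) (hu : ∀ p ∈ U, ContDiffAt ℝ 2 u p) :
    MeasurableSet (parabolicContactSet u U) := by
  have hc : ContinuousOn (fun p => (fderiv ℝ u p, fderiv ℝ (fderiv ℝ u) p)) U := by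
    intro p hp
    have h1 := (hu p hp).fderiv_right (m := 1) (by norm_num)
    exact (h1.continuousAt.prodMk
      (h1.fderiv_right (m := 0) (by norm_num)).continuousAt).continuousWithinAt
  set S : Set ((E × ℝ →L[ℝ] ℝ) × (E × ℝ →L[ℝ] E × ℝ →L[ℝ] ℝ)) :=
    {q | 0 ≤ q.1 (0, 1) ∧ ∀ z : E, q.2 (z, 0) (z, 0) ≤ 0} with hS
  have hScl : IsClosed S := by
    rw [hS, Set.ofPred_and, Set.ofPred_forall]
    refine (isClosed_le (by fun_prop) (by fun_prop)).inter (isClosed_iInter fun z => ?_)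
    exact isClosed_le (by fun_prop) (by fun_prop)
  have hset : parabolicContactSet u U =
      U \ (U ∩ (fun p => (fderiv ℝ u p, fderiv ℝ (fderiv ℝ u) p)) ⁻¹' Sᶜ) := by
    ext p
    simp only [parabolicContactSet, Set.mem_ofPred_eq, Set.mem_sdiff, Set.mem_inter_iff,
      Set.mem_preimage, Set.mem_compl_iff, hS]
    tauto
  rw [hset]
  exact hU.measurableSet.diff
    (hc.isOpen_inter_preimage hU hScl.isOpen_compl).measurableSet

theorem posSemidef_neg_hessian {d : ℕ} {u : EuclideanSpace ℝ (Fin d) × ℝ → ℝ}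
    {p : EuclideanSpace ℝ (Fin d) × ℝ} (hu : ContDiffAt ℝ 2 u p)
    (h : ∀ z, fderiv ℝ (fderiv ℝ u) p (z, 0) (z, 0) ≤ 0) :
    (Matrix.of fun i j : Fin d => -fderiv ℝ (fderiv ℝ u) p
      (EuclideanSpace.single i 1, 0) (EuclideanSpace.single j 1, 0)).PosSemidef := by
  have hsymm := hu.isSymmSndFDerivAt (by simp)
  refine .of_dotProduct_mulVec_nonneg ?_ fun z => ?_
  · ext i j
    simp only [Matrix.conjTranspose_apply, Matrix.of_apply, star_trivial]
    rw [hsymm.eq]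
  · have hz : ((WithLp.toLp 2 z : EuclideanSpace ℝ (Fin d)), (0 : ℝ)) =
        ∑ i, z i • ((EuclideanSpace.single i 1 : EuclideanSpace ℝ (Fin d)), (0 : ℝ)) := by
      refine Prod.ext ?_ (by simp [Prod.snd_sum])
      rw [Prod.fst_sum]
      ext k
      simp [Pi.single_apply]
    have h1 := h (WithLp.toLp 2 z)
    rw [hz] at h1
    simp only [map_sum, map_smul, sum_apply, smul_apply, smul_eq_mul] at h1
    simp only [dotProduct, Matrix.mulVec, Matrix.of_apply, star_trivial]
    rw [← neg_nonneg, ← Finset.sum_neg_distrib] at h1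
    refine h1.trans_eq (Finset.sum_congr rfl fun i _ => ?_)
    rw [← mul_neg, ← Finset.sum_neg_distrib]
    congr 1
    refine Finset.sum_congr rfl fun j _ => ?_
    rw [hsymm.eq]
    ring

theorem measure_le_lintegral_parabolicContactSet {d : ℕ}
    {Ω : Set (EuclideanSpace ℝ (Fin d))} {T m l : ℝ}
    {u : EuclideanSpace ℝ (Fin d) × ℝ → ℝ}
    (hΩ : IsOpen Ω) (hb : Bornology.IsBounded Ω) (hR : 0 < Metric.diam Ω)
    (hT : 0 < T) (hc : ContinuousOn u (closure Ω ×ˢ Set.Icc 0 T))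
    (hu : ∀ p ∈ Ω ×ˢ Set.Ioo 0 T, ContDiffAt ℝ 2 u p)
    (hm : ∀ p ∈ (Ω ×ˢ ({0} : Set ℝ)) ∪ (frontier Ω ×ˢ Set.Icc (0 : ℝ) T), u p ≤ m)
    (hl : 0 < l) (hml : ∃ p ∈ Ω ×ˢ Set.Icc 0 T, m + 2 * l < u p) :
    ENNReal.ofReal ((l / Metric.diam Ω) ^ d * l *
        volume.real (Metric.ball (0 : EuclideanSpace ℝ (Fin d)) 1)) ≤
      ∫⁻ p in parabolicContactSet u (Ω ×ˢ Set.Ioo 0 T), ENNReal.ofReal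
        ((Matrix.of fun i j : Fin d => -fderiv ℝ (fderiv ℝ u) p
          (EuclideanSpace.single i 1, 0) (EuclideanSpace.single j 1, 0)).det *
            fderiv ℝ u p (0, 1)) := by
  obtain ⟨⟨x₀, t₁⟩, ⟨hx₀, ht₁⟩, hlt⟩ := hml
  simp only at hx₀ ht₁
  obtain ⟨t₀, ht₀, hlt₀⟩ : ∃ t₀ ∈ Set.Ico 0 T, m + 2 * l < u (x₀, t₀) := by
    have hcl : t₁ ∈ closure (Set.Ico 0 T) := by rwa [closure_Ico hT.ne]
    have := mem_closure_iff_nhdsWithin_neBot.1 hcl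
    have hcs : ContinuousWithinAt (fun s => u (x₀, s)) (Set.Ico 0 T) t₁ :=
      (hc (x₀, t₁) ⟨subset_closure hx₀, ht₁⟩).comp (f := fun s => (x₀, s))
        (by fun_prop) fun s hs => ⟨subset_closure hx₀, hs.1, hs.2.le⟩
    obtain ⟨s, h1, h2⟩ :=
      ((hcs.tendsto.eventually_const_lt hlt).and self_mem_nhdsWithin).exists
    exact ⟨s, h2, h1⟩
  have hU : IsOpen (Ω ×ˢ Set.Ioo 0 T) := hΩ.prod isOpen_Ioo
  have hsub : Metric.ball (0 : EuclideanSpace ℝ (Fin d)) (l / Metric.diam Ω) ×ˢ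
      Set.Ioo (m + l) (m + 2 * l) ⊆
      parabolicLegendre u x₀ '' parabolicContactSet u (Ω ×ˢ Set.Ioo 0 T) := by
    rintro ⟨q, h⟩ ⟨hq, hh⟩
    rw [mem_ball_zero_iff, lt_div_iff₀ hR] at hq
    obtain ⟨p, hp, hp', hpe⟩ := exists_parabolicLegendre_eq hΩ hb hc hu hm hx₀ ht₀ (q := q) (h := h)
      (by linarith [hh.1]) (hh.2.trans hlt₀)
    exact ⟨p, ⟨hp, hp'⟩, hpe⟩
  have : (volume : Measure (EuclideanSpace ℝ (Fin d) × ℝ)).IsAddHaarMeasure := by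
    rw [Measure.volume_eq_prod]
    infer_instance
  calc _ = volume (Metric.ball (0 : EuclideanSpace ℝ (Fin d)) (l / Metric.diam Ω) ×ˢ
      Set.Ioo (m + l) (m + 2 * l)) := by
        rw [Measure.volume_eq_prod, Measure.prod_prod,
          Measure.addHaar_ball_of_pos _ _ (by positivity), Real.volume_Ioo,
          ENNReal.ofReal_mul (by positivity), ENNReal.ofReal_mul (by positivity),
          ofReal_measureReal, finrank_euclideanSpace_fin]
        ring_nf
    _ ≤ _ := measure_mono hsub
    _ ≤ _ := addHaar_image_le_lintegral_abs_det_fderiv volume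
        (measurableSet_parabolicContactSet hU hu) fun p hp =>
          (((hasFDerivAt_parabolicLegendre (hu p hp.1) x₀).choose_spec.1).differentiableAt
            |>.hasFDerivAt).hasFDerivWithinAt
    _ ≤ _ := setLIntegral_mono' (measurableSet_parabolicContactSet hU hu) fun p hp => by
        rw [det_fderiv_parabolicLegendre (hu p hp.1) x₀, abs_mul, abs_of_nonneg hp.2.1]
        have hpsd := posSemidef_neg_hessian (hu p hp.1) hp.2.2
        rw [← abs_of_nonneg hpsd.det_nonneg]
        change _ ≤ ENNReal.ofReal (|(-Matrix.of fun i j : Fin d => fderiv ℝ (fderiv ℝ u) p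
          (EuclideanSpace.single i 1, 0) (EuclideanSpace.single j 1, 0)).det| * _)
        rw [Matrix.det_neg, abs_mul, abs_pow, abs_neg, abs_one, one_pow, one_mul]

/-- Parabolic Alexandrov–Bakelman–Pucci maximum principle: for every dimension
`d ≥ 1` there is a constant `C_d > 0`, depending only on `d`, such that for
every nonempty bounded open `Ω ⊂ ℝ^d`, every `T > 0`, every `u` smooth on
`closure Ω × [0,T]`, every measurable field `b` of symmetric positive
semidefinite matrices and every `f` with
`Σ_{i,j} b^{ij} ∂_i∂_j u − ∂_t u ≥ f` on `Ω × [0,T]`, one has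
`sup_{Ω×[0,T]} u ≤ sup_{∂_P(Ω×[0,T])} u + C_d (diam Ω)^{d/(d+1)} ‖f⁻/D‖_{L^{d+1}(E)}`,
where `D = (det b)^{1/(d+1)}`, `∂_P(Ω×[0,T]) = (Ω×{0}) ∪ (∂Ω×[0,T])`, and
`E` is the set of points of `Ω×[0,T]` where `∂_t u ≥ 0` and the spatial
Hessian of `u` is negative semidefinite (equivalently, its negation is
positive semidefinite). The right-hand side is computed in `ℝ≥0∞` (via a
lower integral and `ℝ≥0∞` division), so that it is `+∞` wherever `D` vanishes
on `E` while `f⁻ > 0`. -/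
theorem parabolic_abp_maximum_principle (d : ℕ) (hd : 1 ≤ d) :
    ∃ C : ℝ, 0 < C ∧
      ∀ (Ω : Set (EuclideanSpace ℝ (Fin d))) (T : ℝ)
        (u : EuclideanSpace ℝ (Fin d) × ℝ → ℝ)
        (b : EuclideanSpace ℝ (Fin d) × ℝ → Matrix (Fin d) (Fin d) ℝ)
        (f : EuclideanSpace ℝ (Fin d) × ℝ → ℝ),
        Ω.Nonempty → IsOpen Ω → Bornology.IsBounded Ω → 0 < T →
        ContDiffOn ℝ (⊤ : ℕ∞) u (closure Ω ×ˢ Set.Icc 0 T) →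
        (∀ i j : Fin d, Measurable fun p => b p i j) →
        (∀ p ∈ Ω ×ˢ Set.Icc (0 : ℝ) T, (b p).PosSemidef) →
        (∀ p ∈ Ω ×ˢ Set.Icc (0 : ℝ) T, f p ≤
            (∑ i : Fin d, ∑ j : Fin d, b p i j *
              iteratedFDeriv ℝ 2 (fun y => u (y, p.2)) p.1
                ![EuclideanSpace.single i 1, EuclideanSpace.single j 1])
            - deriv (fun s => u (p.1, s)) p.2) →
        ENNReal.ofReal (sSup (u '' (Ω ×ˢ Set.Icc (0 : ℝ) T)) -
            sSup (u '' ((Ω ×ˢ ({0} : Set ℝ)) ∪ (frontier Ω ×ˢ Set.Icc (0 : ℝ) T)))) ≤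
          ENNReal.ofReal (C * Metric.diam Ω ^ ((d : ℝ) / (d + 1))) *
            (∫⁻ p in {p : EuclideanSpace ℝ (Fin d) × ℝ |
                  p ∈ Ω ×ˢ Set.Icc (0 : ℝ) T ∧
                  0 ≤ deriv (fun s => u (p.1, s)) p.2 ∧
                  (Matrix.of fun i j : Fin d =>
                    -(iteratedFDeriv ℝ 2 (fun y => u (y, p.2)) p.1
                      ![EuclideanSpace.single i 1, EuclideanSpace.single j 1])).PosSemidef },
                (ENNReal.ofReal (max (-f p) 0) /
                  ENNReal.ofReal ((Matrix.det (b p)) ^ ((1 : ℝ) / (d + 1)))) ^ (d + 1))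
              ^ ((1 : ℝ) / (d + 1)) := by
  set ω := volume.real (Metric.ball (0 : EuclideanSpace ℝ (Fin d)) 1) with hω
  have hω0 : 0 < ω := by
    rw [hω, measureReal_def]
    exact ENNReal.toReal_pos (Metric.measure_ball_pos _ _ one_pos).ne' measure_ball_lt_top.ne
  refine ⟨4 / ω ^ ((1 : ℝ) / (d + 1)), by positivity, ?_⟩
  intro Ω T u b f hne hΩ hb hT hu _ hbpsd hf
  have : Nonempty (Fin d) := ⟨⟨0, hd⟩⟩
  have hR : 0 < Metric.diam Ω := by
    obtain ⟨x, hx⟩ := hne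
    exact Metric.diam_pos (infinite_of_mem_nhds x (hΩ.mem_nhds hx)).nontrivial hb
  set M := sSup (u '' (Ω ×ˢ Set.Icc (0 : ℝ) T)) -
    sSup (u '' ((Ω ×ˢ ({0} : Set ℝ)) ∪ (frontier Ω ×ˢ Set.Icc (0 : ℝ) T))) with hMdef
  rcases le_or_gt M 0 with hM | hM
  · rw [ENNReal.ofReal_of_nonpos hM]
    exact zero_le
  have hU : IsOpen (Ω ×ˢ Set.Ioo 0 T) := hΩ.prod isOpen_Ioo
  have hu2 : ∀ p ∈ Ω ×ˢ Set.Ioo 0 T, ContDiffAt ℝ 2 u p := fun p hp =>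
    ((hu.mono (Set.prod_mono subset_closure Set.Ioo_subset_Icc_self)).contDiffAt
      (hU.mem_nhds hp)).of_le (show ((2 : ℕ∞) : WithTop ℕ∞) ≤ ((⊤ : ℕ∞) : WithTop ℕ∞) from
        WithTop.coe_le_coe.2 le_top)
  have hbdd : BddAbove (u '' (closure Ω ×ˢ Set.Icc 0 T)) :=
    (hb.isCompact_closure.prod isCompact_Icc).bddAbove_image hu.continuousOn
  have hm : ∀ p ∈ (Ω ×ˢ ({0} : Set ℝ)) ∪ (frontier Ω ×ˢ Set.Icc (0 : ℝ) T),
      u p ≤ sSup (u '' ((Ω ×ˢ ({0} : Set ℝ)) ∪ (frontier Ω ×ˢ Set.Icc (0 : ℝ) T))) := by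
    refine fun p hp => le_csSup (hbdd.mono (Set.image_mono ?_)) (Set.mem_image_of_mem u hp)
    refine Set.union_subset (Set.prod_mono subset_closure ?_)
      (Set.prod_mono frontier_subset_closure le_rfl)
    simpa using hT.le
  have hml : ∃ p ∈ Ω ×ˢ Set.Icc 0 T,
      sSup (u '' ((Ω ×ˢ ({0} : Set ℝ)) ∪ (frontier Ω ×ˢ Set.Icc (0 : ℝ) T))) + 2 * (M / 4) <
        u p := by
    obtain ⟨_, ⟨p, hp, rfl⟩, hlt⟩ := exists_lt_of_lt_csSup
      (b := sSup (u '' ((Ω ×ˢ ({0} : Set ℝ)) ∪ (frontier Ω ×ˢ Set.Icc (0 : ℝ) T))) + 2 * (M / 4))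
      ((hne.prod (Set.nonempty_Icc.2 hT.le)).image u) (by linarith)
    exact ⟨p, hp, hlt⟩
  have hmain := measure_le_lintegral_parabolicContactSet hΩ hb hR hT hu.continuousOn hu2 hm
    (by positivity : 0 < M / 4) hml
  rw [← hω] at hmain
  have hle : ENNReal.ofReal M ≤
      ENNReal.ofReal (4 / ω ^ ((1 : ℝ) / (d + 1)) * Metric.diam Ω ^ ((d : ℝ) / (d + 1))) *
        ENNReal.ofReal ((M / 4 / Metric.diam Ω) ^ d * (M / 4) * ω) ^ ((1 : ℝ) / (d + 1)) := by
    rw [ENNReal.ofReal_rpow_of_nonneg (by positivity) (by positivity),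
      ← ENNReal.ofReal_mul (by positivity)]
    refine ENNReal.ofReal_le_ofReal (le_of_eq ?_)
    have hpow : (M / 4 / Metric.diam Ω) ^ d * (M / 4) =
        (M / 4) ^ (d + 1) / Metric.diam Ω ^ d := by
      rw [div_pow, pow_succ]; ring
    rw [hpow, Real.mul_rpow (by positivity) hω0.le, Real.div_rpow (by positivity) (by positivity),
      ← Real.rpow_natCast (M / 4), ← Real.rpow_natCast (Metric.diam Ω),
      ← Real.rpow_mul (by positivity), ← Real.rpow_mul hR.le]
    push_cast
    rw [mul_one_div_cancel (by positivity), Real.rpow_one, mul_one_div]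
    field_simp
  refine hle.trans (mul_le_mul_right ?_ _)
  refine ENNReal.rpow_le_rpow (hmain.trans ?_) (by positivity)
  refine (setLIntegral_mono' (measurableSet_parabolicContactSet hU hu2) fun p hp => ?_).trans
    (lintegral_mono_set ?_)
  · have hpc : p ∈ Ω ×ˢ Set.Icc 0 T := ⟨hp.1.1, Set.Ioo_subset_Icc_self hp.1.2⟩
    have hpsd := posSemidef_neg_hessian (hu2 p hp.1) hp.2.2
    refine (hbpsd p hpc).ofReal_det_mul_le hpsd hp.2.1 ((hf p hpc).trans_eq ?_)
    rw [deriv_slice_eq ((hu2 p hp.1).differentiableAt (by norm_num)), Matrix.trace,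
      ← Finset.sum_neg_distrib]
    congr 1
    refine Finset.sum_congr rfl fun i _ => ?_
    rw [Matrix.diag_apply, Matrix.mul_apply, ← Finset.sum_neg_distrib]
    refine Finset.sum_congr rfl fun j _ => ?_
    have hij := hpsd.isHermitian.apply i j
    rw [star_trivial] at hij
    rw [iteratedFDeriv_two_slice_eq (hu2 p hp.1), hij, Matrix.of_apply]
    ring
  · intro p hp
    refine ⟨⟨hp.1.1, Set.Ioo_subset_Icc_self hp.1.2⟩, ?_, ?_⟩
    · rw [deriv_slice_eq ((hu2 p hp.1).differentiableAt (by norm_num))]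
      exact hp.2.1
    · simp only [iteratedFDeriv_two_slice_eq (hu2 p hp.1)]
      exact posSemidef_neg_hessian (hu2 p hp.1) hp.2.2
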